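/- arXiv:2005.04256 — 3 statements merged into one kernel-verified Lean document; each statement's English description precedes it below -/
import Mathlib

section
/- Every (n−2)-dimensional linear subspace X of ℓ∞ⁿ with n ≥ 11 contains an equilateral set of cardinality at least n − 1, i.e., e(X) ≥ dim X + 1. (This follows from the bound e(X) ≥ 1 + (1/2) Σ_{r=1}^{2} C(n−4, r) with k = 2, ℓ = 2.) -/
/-- Vectors with entries in `{-1, 0, 1}` and at most two nonzero entries. -/
def IsSparseSign {n : ℕ} (w : Fin n → ℝ) : Prop :=
  (∀ i, w i ∈ ({-1, 0, 1} : Set ℝ)) ∧ (Finset.univ.filter fun i => w i ≠ 0).card ≤ 2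

theorem finite_setOf_isSparseSign (n : ℕ) : {w : Fin n → ℝ | IsSparseSign w}.Finite := by
  refine (Set.Finite.pi' (t := fun _ : Fin n => ({-1, 0, 1} : Set ℝ)) fun _ => ?_).subset
    fun w hw => hw.1
  exact Set.toFinite _

theorem IsSparseSign.abs_le_one {n : ℕ} {w : Fin n → ℝ} (hw : IsSparseSign w) (i : Fin n) :
    |w i| ≤ 1 := by
  have h := hw.1 i
  simp only [Set.mem_insert_iff, Set.mem_singleton_iff] at h
  rcases h with h | h | h <;> rw [h] <;> norm_num

theorem isSparseSign_single {n : ℕ} (i : Fin n) : IsSparseSign (Pi.single i (1 : ℝ)) := by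
  refine ⟨fun j => ?_, ?_⟩
  · by_cases h : j = i
    · subst h; simp
    · simp [h]
  · refine (Finset.card_le_card (t := {i}) fun j hj => ?_).trans (by simp)
    by_contra h
    simp_all

/-- The `2 × 2` determinant of a pair of vectors with respect to two linear functionals. -/
def pairDet {E : Type*} [AddCommGroup E] [Module ℝ E] (f g : E →ₗ[ℝ] ℝ) (u v : E) : ℝ :=
  f u * g v - f v * g u

/-- A subspace of codimension two is cut out by two independent functionals. -/
theorem exists_functionals_of_finrank_quotient_eq_two {E : Type*} [AddCommGroup E] [Module ℝ E]
    (X : Submodule ℝ E) (h : Module.finrank ℝ (E ⧸ X) = 2) :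
    ∃ f g : E →ₗ[ℝ] ℝ, (∀ x, f x = 0 → g x = 0 → x ∈ X) ∧ ∃ u v, pairDet f g u v ≠ 0 := by
  have : FiniteDimensional ℝ (E ⧸ X) := FiniteDimensional.of_finrank_pos (by omega)
  let b := Module.finBasisOfFinrankEq ℝ (E ⧸ X) h
  refine ⟨b.coord 0 ∘ₗ X.mkQ, b.coord 1 ∘ₗ X.mkQ, fun x h0 h1 => ?_, ?_⟩
  · rw [← Submodule.Quotient.mk_eq_zero, ← b.forall_coord_eq_zero_iff]
    intro i
    fin_cases i
    · exact h0
    · exact h1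
  · obtain ⟨u, hu⟩ := X.mkQ_surjective (b 0)
    obtain ⟨v, hv⟩ := X.mkQ_surjective (b 1)
    exact ⟨u, v, by simp only [pairDet, LinearMap.comp_apply, hu, hv]; simp⟩

theorem exists_single_pairDet_ne_zero {n : ℕ} (f g : (Fin n → ℝ) →ₗ[ℝ] ℝ)
    (h : ∃ u v, pairDet f g u v ≠ 0) :
    ∃ i j, pairDet f g (Pi.single i 1) (Pi.single j 1) ≠ 0 := by
  by_contra! H
  obtain ⟨u, v, huv⟩ := h
  have key : ∀ i, (f (Pi.single i 1) • g - g (Pi.single i 1) • f) = 0 := by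
    intro i
    refine LinearMap.pi_ext' fun j => LinearMap.ext_ring ?_
    have := H i j
    simp only [pairDet] at this
    simp only [LinearMap.comp_apply, LinearMap.single_apply, LinearMap.sub_apply,
      LinearMap.smul_apply, smul_eq_mul, LinearMap.zero_apply]
    linarith
  have key2 : g v • f - f v • g = 0 := by
    refine LinearMap.pi_ext' fun j => LinearMap.ext_ring ?_
    have := LinearMap.congr_fun (key j) v
    simp only [LinearMap.comp_apply, LinearMap.single_apply, LinearMap.sub_apply,
      LinearMap.smul_apply, smul_eq_mul, LinearMap.zero_apply] at this ⊢
    linarith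
  have := LinearMap.congr_fun key2 u
  simp only [LinearMap.sub_apply, LinearMap.smul_apply, smul_eq_mul,
    LinearMap.zero_apply] at this
  exact huv (by simp only [pairDet]; linarith)

/-- Two disjointly supported sparse sign vectors with maximal determinant: modulo `X`, every sparse
sign vector away from their supports is a combination of them with coefficients in `[-1, 1]`. -/
theorem exists_sparseSign_pair {n : ℕ} (X : Submodule ℝ (Fin n → ℝ))
    (h : Module.finrank ℝ ((Fin n → ℝ) ⧸ X) = 2) :
    ∃ u v : Fin n → ℝ, IsSparseSign u ∧ IsSparseSign v ∧ (∀ i, u i = 0 ∨ v i = 0) ∧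
      ∃ α β : (Fin n → ℝ) →ₗ[ℝ] ℝ, (∀ w, w - α w • u - β w • v ∈ X) ∧
        ∀ w, IsSparseSign w → (∀ i, w i = 0 ∨ (u i = 0 ∧ v i = 0)) →
          |α w| ≤ 1 ∧ |β w| ≤ 1 := by
  obtain ⟨f, g, hX, hne⟩ := exists_functionals_of_finrank_quotient_eq_two X h
  obtain ⟨i, j, hij⟩ := exists_single_pairDet_ne_zero f g hne
  have hij' : i ≠ j := by
    rintro rfl
    exact hij (by simp [pairDet])
  let T : Set ((Fin n → ℝ) × (Fin n → ℝ)) :=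
    {p | (IsSparseSign p.1 ∧ IsSparseSign p.2) ∧ ∀ i, p.1 i = 0 ∨ p.2 i = 0}
  have hT : T.Finite :=
    ((finite_setOf_isSparseSign n).prod (finite_setOf_isSparseSign n)).subset fun p hp => hp.1
  have hmem : ((Pi.single i 1, Pi.single j 1) : (Fin n → ℝ) × (Fin n → ℝ)) ∈ T := by
    refine ⟨⟨isSparseSign_single i, isSparseSign_single j⟩, fun k => ?_⟩
    by_cases hk : k = i
    · subst hk; right; simp [hij']
    · left; simp [hk]
  obtain ⟨⟨u, v⟩, ⟨⟨hu, hv⟩, huv⟩, hmax⟩ :=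
    Set.exists_max_image T (fun p => |pairDet f g p.1 p.2|) hT ⟨_, hmem⟩
  have hd : 0 < |pairDet f g u v| := (abs_pos.mpr hij).trans_le (hmax _ hmem)
  have hd0 : pairDet f g u v ≠ 0 := abs_pos.mp hd
  refine ⟨u, v, hu, hv, huv, (pairDet f g u v)⁻¹ • (g v • f - f v • g),
    (pairDet f g u v)⁻¹ • (f u • g - g u • f), fun w => hX _ ?_ ?_, fun w hw hwuv => ⟨?_, ?_⟩⟩
  · simp only [map_sub, map_smul, LinearMap.sub_apply, LinearMap.smul_apply, smul_eq_mul]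
    field_simp
    simp only [pairDet]
    ring
  · simp only [map_sub, map_smul, LinearMap.sub_apply, LinearMap.smul_apply, smul_eq_mul]
    field_simp
    simp only [pairDet]
    ring
  · have hle := hmax (w, v) ⟨⟨hw, hv⟩, fun i => (hwuv i).imp id And.right⟩
    have heq : (g v • f - f v • g) w = pairDet f g w v := by
      simp only [pairDet, LinearMap.sub_apply, LinearMap.smul_apply, smul_eq_mul]
      ring
    rw [LinearMap.smul_apply, smul_eq_mul, abs_mul, abs_inv, inv_mul_le_one₀ hd, heq]
    exact hle
  · have hle := hmax (u, w) ⟨⟨hu, hw⟩, fun i => (hwuv i).symm.imp And.left id⟩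
    have heq : (f u • g - g u • f) w = pairDet f g u w := by
      simp only [pairDet, LinearMap.sub_apply, LinearMap.smul_apply, smul_eq_mul]
      ring
    rw [LinearMap.smul_apply, smul_eq_mul, abs_mul, abs_inv, inv_mul_le_one₀ hd, heq]
    exact hle

/-- At least half of any index set can be signed so that two given real functions become
nonnegative up to a global sign of the second one. -/
theorem exists_half_signed {ι : Type*} (M : Finset ι) (a b : ι → ℝ) :
    ∃ C ⊆ M, M.card ≤ 2 * C.card ∧ ∃ ε : ℝ, |ε| = 1 ∧ ∃ σ : ι → ℝ,
      (∀ i, σ i = 1 ∨ σ i = -1) ∧ ∀ i ∈ C, 0 ≤ σ i * a i ∧ 0 ≤ ε * (σ i * b i) := by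
  classical
  have signs : ∀ x y : ℝ, 0 ≤ x * y →
      ∃ s : ℝ, (s = 1 ∨ s = -1) ∧ 0 ≤ s * x ∧ 0 ≤ s * y := by
    intro x y hxy
    rcases mul_nonneg_iff.mp hxy with ⟨h1, h2⟩ | ⟨h1, h2⟩
    · exact ⟨1, .inl rfl, by linarith, by linarith⟩
    · exact ⟨-1, .inr rfl, by linarith, by linarith⟩
  have main : ∀ ε : ℝ, ∃ σ : ι → ℝ, (∀ i, σ i = 1 ∨ σ i = -1) ∧
      ∀ i, 0 ≤ a i * (ε * b i) → 0 ≤ σ i * a i ∧ 0 ≤ ε * (σ i * b i) := by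
    intro ε
    have : ∀ i, ∃ s : ℝ, (s = 1 ∨ s = -1) ∧
        (0 ≤ a i * (ε * b i) → 0 ≤ s * a i ∧ 0 ≤ ε * (s * b i)) := by
      intro i
      by_cases h : 0 ≤ a i * (ε * b i)
      · obtain ⟨s, hs, h1, h2⟩ := signs _ _ h
        exact ⟨s, hs, fun _ => ⟨h1, by linarith⟩⟩
      · exact ⟨1, .inl rfl, fun h' => absurd h' h⟩
    choose σ h1 h2 using this
    exact ⟨σ, h1, h2⟩
  have hsplit := M.card_filter_add_card_filter_not (fun i => 0 ≤ a i * b i)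
  by_cases hP : M.card ≤ 2 * (M.filter fun i => 0 ≤ a i * b i).card
  · obtain ⟨σ, h1, h2⟩ := main 1
    refine ⟨_, M.filter_subset _, hP, 1, by simp, σ, h1, fun i hi => h2 i ?_⟩
    simpa using (Finset.mem_filter.mp hi).2
  · obtain ⟨σ, h1, h2⟩ := main (-1)
    refine ⟨_, M.filter_subset fun i => ¬ 0 ≤ a i * b i, by omega, -1, by simp, σ, h1,
      fun i hi => h2 i ?_⟩
    have := (Finset.mem_filter.mp hi).2
    linarith

theorem card_le_card_filter_powerset {ι : Type*} [DecidableEq ι] (C : Finset ι)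
    (h : 4 ≤ C.card) : 2 * C.card + 3 ≤ (C.powerset.filter (·.card ≤ 2)).card := by
  have hsub : (C.powersetCard 2 ∪ C.powersetCard 1) ∪ C.powersetCard 0 ⊆
      C.powerset.filter (·.card ≤ 2) := by
    intro R hR
    simp only [Finset.mem_union, Finset.mem_powersetCard] at hR
    simp only [Finset.mem_filter, Finset.mem_powerset]
    rcases hR with (⟨h1, h2⟩ | ⟨h1, h2⟩) | ⟨h1, h2⟩ <;> exact ⟨h1, by omega⟩
  refine le_trans ?_ (Finset.card_le_card hsub)
  have hd : ∀ i j, i ≠ j → Disjoint (C.powersetCard i) (C.powersetCard j) :=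
    fun i j hij => C.pairwise_disjoint_powersetCard hij
  rw [Finset.card_union_of_disjoint, Finset.card_union_of_disjoint (hd 2 1 (by decide))]
  · simp only [Finset.card_powersetCard, Nat.choose_one_right, Nat.choose_zero_right]
    obtain ⟨p, hp⟩ := Nat.exists_eq_add_of_le h
    rw [hp, Nat.choose_two_right]
    have : 6 + p ≤ (4 + p) * (4 + p - 1) / 2 := by
      rw [Nat.le_div_iff_mul_le (by norm_num), show 4 + p - 1 = 3 + p by omega]
      nlinarith
    omega
  · exact Finset.disjoint_union_left.mpr ⟨hd 2 0 (by decide), hd 1 0 (by decide)⟩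

theorem stmt5 (n : ℕ) (hn : 11 ≤ n) (X : Submodule ℝ (Fin n → ℝ))
    (hdim : Module.finrank ℝ X = n - 2) :
    ∃ S : Finset (Fin n → ℝ), (∀ x ∈ S, x ∈ X) ∧
      (∃ c : ℝ, 0 < c ∧ ∀ x ∈ S, ∀ y ∈ S, x ≠ y → dist x y = c) ∧
      n - 1 ≤ S.card := by
  classical
  have hquot : Module.finrank ℝ ((Fin n → ℝ) ⧸ X) = 2 := by
    have := X.finrank_quotient_add_finrank
    rw [Module.finrank_fin_fun] at this
    omega
  obtain ⟨u, v, hu, hv, huv, α, β, hX, hbound⟩ := exists_sparseSign_pair X hquot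
  let M : Finset (Fin n) := {i | u i = 0 ∧ v i = 0}
  have hM : n ≤ M.card + 4 := by
    let U : Finset (Fin n) := {i | u i ≠ 0}
    let V : Finset (Fin n) := {i | v i ≠ 0}
    have hcov : (Finset.univ : Finset (Fin n)) ⊆ M ∪ (U ∪ V) := by
      intro i _
      simp only [M, U, V, Finset.mem_union, Finset.mem_filter, Finset.mem_univ, true_and]
      tauto
    have h1 := Finset.card_le_card hcov
    have h2 := Finset.card_union_le M (U ∪ V)
    have h3 := Finset.card_union_le U V
    have h4 : U.card ≤ 2 := hu.2
    have h5 : V.card ≤ 2 := hv.2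
    rw [Finset.card_univ, Fintype.card_fin] at h1
    omega
  obtain ⟨C, hCM, hC, ε, hε, σ, hσ, hpos⟩ := exists_half_signed M
    (fun i => α (Pi.single i 1)) (fun i => β (Pi.single i 1))
  let w : Finset (Fin n) → Fin n → ℝ := fun R => ∑ i ∈ R, σ i • Pi.single i (1 : ℝ)
  have w_apply : ∀ R i, w R i = if i ∈ R then σ i else 0 := by
    intro R i
    simp [w, Finset.sum_apply, Pi.single_apply]
  let F := C.powerset.filter (·.card ≤ 2)
  have hF : ∀ R ∈ F, R ⊆ C ∧ R.card ≤ 2 := fun R hR => by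
    simpa [F] using hR
  have hw0 : ∀ R ∈ F, ∀ i, w R i = 0 ∨ (u i = 0 ∧ v i = 0) := by
    intro R hR i
    by_cases hi : i ∈ R
    · right
      simpa [M] using hCM ((hF R hR).1 hi)
    · left
      rw [w_apply, if_neg hi]
  have hw : ∀ R ∈ F, IsSparseSign (w R) := by
    intro R hR
    refine ⟨fun i => ?_, (Finset.card_le_card fun i hi => ?_).trans (hF R hR).2⟩
    · rw [w_apply]
      split_ifs
      · rcases hσ i with h | h <;> simp [h]
      · simp
    · by_contra h
      simp [w_apply, h] at hi
  have hα : ∀ R ∈ F, 0 ≤ α (w R) ∧ α (w R) ≤ 1 := fun R hR =>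
    ⟨by
      simp only [w, map_sum, map_smul, smul_eq_mul]
      exact Finset.sum_nonneg fun i hi => (hpos i ((hF R hR).1 hi)).1,
    (le_abs_self _).trans (hbound _ (hw R hR) (hw0 R hR)).1⟩
  have hβ : ∀ R ∈ F, 0 ≤ ε * β (w R) ∧ ε * β (w R) ≤ 1 := fun R hR =>
    ⟨by
      simp only [w, map_sum, map_smul, smul_eq_mul, Finset.mul_sum]
      exact Finset.sum_nonneg fun i hi => (hpos i ((hF R hR).1 hi)).2,
    (le_abs_self _).trans
      (by rw [abs_mul, hε, one_mul]; exact (hbound _ (hw R hR) (hw0 R hR)).2)⟩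
  let x : Finset (Fin n) → Fin n → ℝ := fun R => w R - α (w R) • u - β (w R) • v
  have x_apply : ∀ R i, x R i = w R i - α (w R) * u i - β (w R) * v i := fun R i => rfl
  have hdist : ∀ R ∈ F, ∀ R' ∈ F, R ≠ R' → dist (x R) (x R') = 1 := by
    intro R hR R' hR' hne
    apply le_antisymm
    · refine (dist_pi_le_iff zero_le_one).mpr fun i => ?_
      rw [Real.dist_eq, x_apply, x_apply]
      by_cases hui : u i = 0
      · by_cases hvi : v i = 0
        · rw [hui, hvi, w_apply, w_apply]
          rcases hσ i with h | h <;> rw [h] <;> split_ifs <;> norm_num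
        · rw [hui, (hw0 R hR i).resolve_right fun h => hvi h.2,
            (hw0 R' hR' i).resolve_right fun h => hvi h.2,
            show (0 : ℝ) - α (w R) * 0 - β (w R) * v i - (0 - α (w R') * 0 - β (w R') * v i) =
              (β (w R') - β (w R)) * v i by ring, abs_mul]
          refine mul_le_one₀ ?_ (abs_nonneg _) (hv.abs_le_one i)
          rw [← one_mul |_|, ← hε, ← abs_mul, hε, abs_le]
          constructor <;> linarith [hβ R hR, hβ R' hR']
      · rw [(huv i).resolve_left hui, (hw0 R hR i).resolve_right fun h => hui h.1,
          (hw0 R' hR' i).resolve_right fun h => hui h.1,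
          show (0 : ℝ) - α (w R) * u i - β (w R) * 0 - (0 - α (w R') * u i - β (w R') * 0) =
            (α (w R') - α (w R)) * u i by ring, abs_mul]
        refine mul_le_one₀ ?_ (abs_nonneg _) (hu.abs_le_one i)
        rw [abs_le]
        constructor <;> linarith [hα R hR, hα R' hR']
    · obtain ⟨i, hi⟩ : ∃ i, ¬(i ∈ R ↔ i ∈ R') := by
        by_contra! h
        exact hne (Finset.ext h)
      have hiC : i ∈ C := by
        by_contra h
        exact hi ⟨fun h' => absurd ((hF R hR).1 h') h, fun h' => absurd ((hF R' hR').1 h') h⟩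
      have hi0 : u i = 0 ∧ v i = 0 := by simpa [M] using hCM hiC
      refine le_trans ?_ (dist_le_pi_dist (x R) (x R') i)
      rw [Real.dist_eq, x_apply, x_apply, hi0.1, hi0.2, w_apply, w_apply]
      rcases hσ i with h | h <;> rw [h] <;> split_ifs <;> first | tauto | norm_num
  refine ⟨F.image x, ?_, ⟨1, one_pos, ?_⟩, ?_⟩
  · intro y hy
    obtain ⟨R, -, rfl⟩ := Finset.mem_image.mp hy
    exact hX _
  · intro y hy z hz hyz
    obtain ⟨R, hR, rfl⟩ := Finset.mem_image.mp hy
    obtain ⟨R', hR', rfl⟩ := Finset.mem_image.mp hz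
    exact hdist R hR R' hR' fun h => hyz (h ▸ rfl)
  · rw [Finset.card_image_of_injOn]
    · have : 2 * C.card + 3 ≤ F.card := card_le_card_filter_powerset C (by omega)
      omega
    · intro R hR R' hR' h
      by_contra hne
      have := hdist R hR R' hR' hne
      rw [h, dist_self] at this
      exact zero_ne_one this
end

section
/- Every (n−3)-dimensional linear subspace X of ℓ∞ⁿ with n ≥ 18 satisfies e(X) ≥ n − 2 = dim X + 1. (This follows from the bound e(X) ≥ 1 + (1/4) Σ_{r=1}^{2} C(n−6, r) with k = 3, ℓ = 2.) -/
/-- A finite spanning family of a real vector space contains a basis in which every member of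
the family has coordinates in `[-1, 1]`. -/
theorem exists_injective_bounded_coords {ι V : Type*} [Finite ι] [AddCommGroup V] [Module ℝ V]
    [FiniteDimensional ℝ V] (v : ι → V) (hv : Submodule.span ℝ (Set.range v) = ⊤) :
    ∃ f : Fin (Module.finrank ℝ V) → ι, Function.Injective f ∧
      ∀ j, ∃ c : Fin (Module.finrank ℝ V) → ℝ, (∀ i, |c i| ≤ 1) ∧ v j = ∑ i, c i • v (f i) := by
  have hd : Module.finrank ℝ (Submodule.span ℝ (Set.range v)) = Module.finrank ℝ V := by
    rw [hv, finrank_top]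
  obtain ⟨b, hb, hspan, hli⟩ := Submodule.exists_fun_fin_finrank_span_eq ℝ (Set.range v)
  rw [← hd]
  choose g hg using hb
  let e := Module.Basis.mk hli (hspan.trans hv).ge
  have heg : v ∘ g = e := by
    ext i
    simp [e, hg]
  have : Nonempty (Fin (Module.finrank ℝ (Submodule.span ℝ (Set.range v))) → ι) := ⟨g⟩
  obtain ⟨f, hf⟩ := Finite.exists_max
    fun f : Fin (Module.finrank ℝ (Submodule.span ℝ (Set.range v))) → ι => |e.det (v ∘ f)|
  have hpos : 0 < |e.det (v ∘ f)| := by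
    refine lt_of_lt_of_le ?_ (hf g)
    rw [heg, e.det_self]
    norm_num
  obtain ⟨hfli, hfspan⟩ := e.is_basis_iff_det.2 (abs_pos.1 hpos).isUnit
  refine ⟨f, hfli.injective.of_comp, fun j => ?_⟩
  let b' := Module.Basis.mk hfli hfspan.ge
  refine ⟨b'.repr (v j), fun i => ?_, ?_⟩
  · have h := congrArg (fun φ => |φ (v j)|) (e.det_smul_mk_coord_eq_det_update hfli hfspan.ge i)
    have h2 := hf (Function.update f i j)
    simp only [LinearMap.smul_apply, smul_eq_mul, abs_mul, Module.Basis.coord_apply,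
      MultilinearMap.toLinearMap_apply] at h
    rw [Function.comp_update] at h2
    exact le_of_mul_le_mul_left ((h.trans_le h2).trans_eq (mul_one _).symm) hpos
  · conv_lhs => rw [← b'.sum_repr (v j)]
    simp [b']

/-- Every finite family in a real vector space of dimension at most `d` contains at most `d`
members such that all members are combinations of these with coefficients in `[-1, 1]`. -/
theorem exists_finset_bounded_coeffs {ι V : Type*} [AddCommGroup V] [Module ℝ V]
    [FiniteDimensional ℝ V] (v : ι → V) (s : Finset ι) :
    ∃ B ⊆ s, B.card ≤ Module.finrank ℝ V ∧
      ∀ j ∈ s, ∃ c : ι → ℝ, (∀ i, |c i| ≤ 1) ∧ v j = ∑ i ∈ B, c i • v i := by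
  classical
  let u : s → Submodule.span ℝ (Set.range fun i : s => v i) :=
    fun i => ⟨v i, Submodule.subset_span ⟨i, rfl⟩⟩
  obtain ⟨f, hf, h⟩ := exists_injective_bounded_coords u (by
    rw [eq_top_iff, ← Submodule.span_span_coe_preimage]
    refine Submodule.span_mono ?_
    rintro ⟨x, hx⟩ ⟨i, hi⟩
    exact ⟨i, Subtype.ext hi⟩)
  have hinj : Function.Injective fun i => (f i : ι) := Subtype.val_injective.comp hf
  refine ⟨Finset.univ.map ⟨_, hinj⟩, ?_, ?_, fun j hj => ?_⟩
  · intro x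
    simp only [Finset.mem_map, Finset.mem_univ, true_and, Function.Embedding.coeFn_mk]
    rintro ⟨i, rfl⟩
    exact (f i).2
  · simpa using Submodule.finrank_le _
  · obtain ⟨c, hc, hjc⟩ := h ⟨j, hj⟩
    refine ⟨Function.extend (fun i => (f i : ι)) c 0, fun i => ?_, ?_⟩
    · by_cases hi : ∃ k, (f k : ι) = i
      · obtain ⟨k, rfl⟩ := hi
        rw [hinj.extend_apply c 0 k]
        exact hc k
      · simp [Function.extend_apply' _ _ _ hi]
    · have := congrArg Subtype.val hjc
      simp only [u, Submodule.coe_sum, Submodule.coe_smul] at this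
      simp only [Finset.sum_map, Function.Embedding.coeFn_mk]
      rw [this]
      exact Finset.sum_congr rfl fun k _ => by rw [hinj.extend_apply c 0 k]

/-- For a subspace `X` of codimension `k` in `ℝⁿ`, outside a set `T` of at most `k * m`
coordinates, `m` times each unit vector is congruent modulo `X` to a vector of sup-norm at most `1`
supported on `T`. -/
theorem exists_finset_small_correction {n : ℕ} (X : Submodule ℝ (Fin n → ℝ)) (m : ℕ) :
    ∃ T : Finset (Fin n), T.card ≤ Module.finrank ℝ ((Fin n → ℝ) ⧸ X) * m ∧
      ∀ j ∉ T, ∃ w : Fin n → ℝ, (∀ b ∉ T, w b = 0) ∧ (∀ b, |w b| ≤ 1) ∧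
        (m : ℝ) • Pi.single j 1 - w ∈ X := by
  classical
  induction m with
  | zero => exact ⟨∅, by simp, fun j _ => ⟨0, by simp, by simp, by simp⟩⟩
  | succ m ih =>
    obtain ⟨T, hT, h⟩ := ih
    obtain ⟨B, hB, hBc, hB'⟩ := exists_finset_bounded_coeffs
      (fun j : Fin n => X.mkQ (Pi.single j 1)) Tᶜ
    have hBT : ∀ b ∈ B, b ∉ T := fun b hb => by simpa using hB hb
    refine ⟨T ∪ B, ?_, fun j hj => ?_⟩
    · rw [mul_add, mul_one]
      exact (Finset.card_union_le _ _).trans (add_le_add hT hBc)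
    · simp only [Finset.mem_union, not_or] at hj
      obtain ⟨w, hw, hw1, hwX⟩ := h j hj.1
      obtain ⟨c, hc, hjc⟩ := hB' j (by simpa using hj.1)
      let y : Fin n → ℝ := ∑ i ∈ B, c i • Pi.single i 1
      have hy : ∀ b, y b = if b ∈ B then c b else 0 := fun b => by
        simp [y, Finset.sum_apply, Pi.single_apply]
      have hyX : Pi.single j 1 - y ∈ X := by
        rw [← Submodule.Quotient.eq, ← Submodule.mkQ_apply, ← Submodule.mkQ_apply, hjc]
        simp [y, map_sum]
      refine ⟨w + y, fun b hb => ?_, fun b => ?_, ?_⟩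
      · simp only [Finset.mem_union, not_or] at hb
        simp [hw b hb.1, hy, hb.2]
      · by_cases hb : b ∈ B
        · simpa [hw b (hBT b hb), hy, hb] using hc b
        · simpa [hy, hb] using hw1 b
      · convert X.add_mem hwX hyX using 1
        push_cast
        rw [add_smul, one_smul]
        abel

theorem stmt6 (n : ℕ) (hn : 18 ≤ n) (X : Submodule ℝ (Fin n → ℝ))
    (hdim : Module.finrank ℝ X = n - 3) :
    ∃ S : Finset (Fin n → ℝ), (∀ x ∈ S, x ∈ X) ∧
      (∃ c : ℝ, 0 < c ∧ ∀ x ∈ S, ∀ y ∈ S, x ≠ y → dist x y = c) ∧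
      n - 2 ≤ S.card := by
  classical
  have hq := X.finrank_quotient_add_finrank
  rw [hdim, Module.finrank_fin_fun] at hq
  obtain ⟨T, hT, h⟩ := exists_finset_small_correction X 4
  rw [show Module.finrank ℝ ((Fin n → ℝ) ⧸ X) = 3 by omega] at hT
  have hz : ∀ j : Fin n, ∃ z ∈ X, j ∉ T → (∀ b ∉ T, z b = if b = j then 1 else 0) ∧
      ∀ b ∈ T, |z b| ≤ 1 / 4 := by
    intro j
    by_cases hj : j ∈ T
    · exact ⟨0, X.zero_mem, fun h => absurd hj h⟩
    obtain ⟨w, hw, hw1, hwX⟩ := h j hj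
    refine ⟨_, X.smul_mem (1 / 4 : ℝ) hwX, fun _ => ⟨fun b hb => ?_, fun b hb => ?_⟩⟩
    · by_cases hbj : b = j <;> simp [hw b hb, hbj]
      simp [show w j = 0 from hw j hj]
    · have hbj : b ≠ j := fun h => hj (h ▸ hb)
      simp only [Pi.smul_apply, Pi.sub_apply, Pi.single_apply, hbj, if_false, smul_eq_mul,
        mul_zero, zero_sub, abs_mul, abs_neg]
      norm_num
      linarith [hw1 b]
  choose z hzX hz using hz
  let F : Finset (Finset (Fin n)) := Tᶜ.powersetCard 1 ∪ Tᶜ.powersetCard 2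
  have hF : ∀ J ∈ F, (∀ j ∈ J, j ∉ T) ∧ J.card ≤ 2 := by
    intro J hJ
    simp only [F, Finset.mem_union, Finset.mem_powersetCard] at hJ
    rcases hJ with hJ | hJ <;> exact ⟨fun j hj => by simpa using hJ.1 hj, by omega⟩
  let x : Finset (Fin n) → Fin n → ℝ := fun J => ∑ j ∈ J, z j
  have hx : ∀ J ∈ F, ∀ b ∉ T, x J b = if b ∈ J then 1 else 0 := by
    intro J hJ b hb
    simp only [x, Finset.sum_apply]
    rw [Finset.sum_congr rfl fun j hj => (hz j ((hF J hJ).1 j hj)).1 b hb]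
    simp
  have hxT : ∀ J ∈ F, ∀ b ∈ T, |x J b| ≤ 1 / 2 := by
    intro J hJ b hb
    simp only [x, Finset.sum_apply]
    have hle := (Finset.abs_sum_le_sum_abs _ _).trans
      (Finset.sum_le_card_nsmul J _ _ fun j hj => (hz j ((hF J hJ).1 j hj)).2 b hb)
    have hc : (J.card : ℝ) ≤ 2 := by exact_mod_cast (hF J hJ).2
    rw [nsmul_eq_mul] at hle
    linarith
  have hdist : ∀ I ∈ F, ∀ J ∈ F, I ≠ J → dist (x I) (x J) = 1 := by
    intro I hI J hJ hne
    refine le_antisymm ((dist_pi_le_iff zero_le_one).2 fun b => ?_) ?_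
    · rw [Real.dist_eq]
      by_cases hb : b ∈ T
      · linarith [abs_sub (x I b) (x J b), hxT I hI b hb, hxT J hJ b hb]
      · rw [hx I hI b hb, hx J hJ b hb]
        split_ifs <;> norm_num
    · obtain ⟨b, hb⟩ : ∃ b, ¬ (b ∈ I ↔ b ∈ J) := by
        by_contra! hcon
        exact hne (Finset.ext hcon)
      have hbT : b ∉ T := by
        by_cases hbI : b ∈ I
        · exact (hF I hI).1 b hbI
        · exact (hF J hJ).1 b (by tauto)
      refine le_trans ?_ (dist_le_pi_dist (x I) (x J) b)
      rw [Real.dist_eq, hx I hI b hbT, hx J hJ b hbT]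
      by_cases hbI : b ∈ I <;> by_cases hbJ : b ∈ J <;> simp_all
  refine ⟨F.image x, ?_, ⟨1, one_pos, ?_⟩, ?_⟩
  · intro y hy
    obtain ⟨J, -, rfl⟩ := Finset.mem_image.1 hy
    exact X.sum_mem fun j _ => hzX j
  · intro y hy y' hy' hne
    obtain ⟨I, hI, rfl⟩ := Finset.mem_image.1 hy
    obtain ⟨J, hJ, rfl⟩ := Finset.mem_image.1 hy'
    exact hdist I hI J hJ fun h => hne (h ▸ rfl)
  · rw [Finset.card_image_of_injOn fun I hI J hJ hIJ => by
      by_contra hne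
      have := hdist I hI J hJ hne
      simp [hIJ] at this]
    rw [Finset.card_union_of_disjoint (Finset.pairwise_disjoint_powersetCard _ (by norm_num)),
      Finset.card_powersetCard, Finset.card_powersetCard, Nat.choose_one_right,
      Finset.card_compl, Fintype.card_fin]
    have h2 : Nat.choose 6 2 ≤ (n - T.card).choose 2 := Nat.choose_le_choose 2 (by omega)
    norm_num [Nat.choose] at h2
    omega
end

section
/- Let X be ℝ^d equipped with two norms ‖·‖_X and ‖·‖_Y satisfying ‖x‖_Y ≤ ‖x‖_X ≤ (1+c)‖x‖_Y for all x, where ‖·‖_X is the restriction of the sup-norm of ℓ∞ⁿ under a linear embedding. Suppose for every ε ∈ [0,c]^M (M = {(i,j) : 1 ≤ i < j ≤ N}) there are points p₁(ε), …, p_N(ε) depending continuously on ε with ‖p_i(ε) − p_j(ε)‖_X = 1 + ε_j^i for all i < j. Then Y contains a 1-equilateral set of cardinality N. -/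
/-- A sum over ordered pairs of distinct indices of a symmetric function vanishes modulo two. -/
lemma sum_sum_erase_eq_zero {ι : Type*} [DecidableEq ι] (S : Finset ι) (g : ι → ι → ZMod 2)
    (hg : ∀ i j, g i j = g j i) : ∑ j ∈ S, ∑ i ∈ S.erase j, g j i = 0 := by
  rw [Finset.sum_sigma']
  refine Finset.sum_involution (fun q _ => ⟨q.2, q.1⟩) ?_ ?_ ?_ ?_
  · rintro ⟨j, i⟩ _
    rw [hg i j]
    exact CharTwo.add_self_eq_zero _
  · rintro ⟨j, i⟩ h _ heq
    simp only [Finset.mem_sigma, Finset.mem_erase] at h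
    simp only [Sigma.mk.injEq] at heq
    exact h.2.1 heq.1
  · rintro ⟨j, i⟩ h
    simp only [Finset.mem_sigma, Finset.mem_erase] at h ⊢
    exact ⟨h.2.2, Ne.symm h.2.1, h.1⟩
  · rintro ⟨j, i⟩ _
    rfl

lemma sum_sum_erase_comm {ι : Type*} [DecidableEq ι] (S : Finset ι) (g : ι → ι → ZMod 2) :
    ∑ j ∈ S, ∑ i ∈ S.erase j, g j i = ∑ j ∈ S, ∑ i ∈ S.erase j, g i j := by
  refine Finset.sum_comm' fun x y => ?_
  simp only [Finset.mem_erase]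
  grind

/-- The cubical cup product modulo two of the coboundaries of the functions in a list, evaluated
on the cube with least vertex `x` and edge directions `S`. -/
def cupDiff {ι : Type*} [DecidableEq ι] :
    List ((ι → ℕ) → ZMod 2) → Finset ι → (ι → ℕ) → ZMod 2
  | [], _, _ => 1
  | f :: L, S, x =>
    ∑ j ∈ S, (f (x + Pi.single j 1) - f x) * cupDiff L (S.erase j) (x + Pi.single j 1)

/-- A cup product of coboundaries is closed. -/
lemma sum_cupDiff_add_single {ι : Type*} [DecidableEq ι] (L : List ((ι → ℕ) → ZMod 2)) :
    ∀ (S : Finset ι) (x : ι → ℕ),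
      ∑ j ∈ S, cupDiff L (S.erase j) (x + Pi.single j 1) = ∑ j ∈ S, cupDiff L (S.erase j) x := by
  induction L with
  | nil => intro S x; rfl
  | cons f L ih =>
    intro S x
    have hupper : ∑ j ∈ S, cupDiff (f :: L) (S.erase j) (x + Pi.single j 1) =
        - ∑ j ∈ S, ∑ i ∈ S.erase j,
          f (x + Pi.single j 1) * cupDiff L ((S.erase j).erase i) (x + Pi.single j 1) := by
      have hsymm := sum_sum_erase_eq_zero S
        (fun j i => f (x + Pi.single j 1 + Pi.single i 1) *
          cupDiff L ((S.erase j).erase i) (x + Pi.single j 1 + Pi.single i 1))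
        (fun i j => by rw [Finset.erase_right_comm, add_right_comm])
      simp only [cupDiff, sub_mul, Finset.sum_sub_distrib]
      rw [hsymm, zero_sub]
      congr 1
      refine Finset.sum_congr rfl fun j _ => ?_
      rw [← Finset.mul_sum, ih, Finset.mul_sum]
    have hlower : ∑ j ∈ S, cupDiff (f :: L) (S.erase j) x =
        ∑ j ∈ S, ∑ i ∈ S.erase j,
          f (x + Pi.single j 1) * cupDiff L ((S.erase j).erase i) (x + Pi.single j 1) := by
      have hsymm := sum_sum_erase_eq_zero S
        (fun j i => f x * cupDiff L ((S.erase j).erase i) x)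
        (fun i j => by rw [Finset.erase_right_comm])
      have hbase : ∑ j ∈ S, ∑ i ∈ S.erase j,
          f x * cupDiff L ((S.erase j).erase i) (x + Pi.single i 1) = 0 := by
        rw [← hsymm]
        refine Finset.sum_congr rfl fun j _ => ?_
        rw [← Finset.mul_sum, ih, Finset.mul_sum]
      simp only [cupDiff, sub_mul, Finset.sum_sub_distrib]
      rw [hbase, sub_zero, sum_sum_erase_comm]
      simp only [Finset.erase_right_comm]
    rw [hupper, hlower, CharTwo.neg_eq]

lemma cupDiff_cons_eq_sum_sub {ι : Type*} [DecidableEq ι] (f : (ι → ℕ) → ZMod 2)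
    (L : List ((ι → ℕ) → ZMod 2)) (S : Finset ι) (x : ι → ℕ) :
    cupDiff (f :: L) S x =
      ∑ j ∈ S, (f (x + Pi.single j 1) * cupDiff L (S.erase j) (x + Pi.single j 1) -
        f x * cupDiff L (S.erase j) x) := by
  simp only [cupDiff, sub_mul, Finset.sum_sub_distrib]
  rw [← Finset.mul_sum, sum_cupDiff_add_single, Finset.mul_sum]

/-- If a cup product of coboundaries is nonzero on a cube, then every factor takes two different
values on the vertices of that cube. -/
lemma exists_ne_of_cupDiff_ne_zero {ι : Type*} [DecidableEq ι] (L : List ((ι → ℕ) → ZMod 2)) :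
    ∀ (S : Finset ι) (x : ι → ℕ), cupDiff L S x ≠ 0 → ∀ f ∈ L,
      ∃ y ∈ Set.Icc x (x + fun i => if i ∈ S then 1 else 0),
        ∃ z ∈ Set.Icc x (x + fun i => if i ∈ S then 1 else 0), f y ≠ f z := by
  induction L with
  | nil => simp
  | cons g L ih =>
    intro S x hne f hf
    obtain ⟨j, hj, hterm⟩ := Finset.exists_ne_zero_of_sum_ne_zero hne
    have hvertex : x + Pi.single j 1 ≤ x + fun i => if i ∈ S then 1 else 0 := by
      intro i
      by_cases hij : i = j
      · subst hij; simp [hj]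
      · simp [Pi.single_eq_of_ne hij]
    have hle : x ≤ x + Pi.single j 1 := le_add_of_nonneg_right zero_le
    rcases List.mem_cons.mp hf with rfl | hfL
    · exact ⟨_, ⟨hle, hvertex⟩, x, ⟨le_rfl, hle.trans hvertex⟩,
        sub_ne_zero.mp (left_ne_zero_of_mul hterm)⟩
    · have hsub : Set.Icc (x + Pi.single j 1)
          (x + Pi.single j 1 + fun i => if i ∈ S.erase j then 1 else 0) ⊆
          Set.Icc x (x + fun i => if i ∈ S then 1 else 0) := by
        refine Set.Icc_subset_Icc hle fun i => ?_
        by_cases hij : i = j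
        · subst hij; simp [hj]
        · simp [hij]
      obtain ⟨y, hy, z, hz, hyz⟩ := ih _ _ (right_ne_zero_of_mul hterm) f hfL
      exact ⟨y, hsub hy, z, hsub hz, hyz⟩

/-- The least vertices of the unit cubes with edge directions `S` which tile the face of
the grid `{0, …, k}^ι` through `b` in the directions `S`. -/
def gridFace {ι : Type*} [DecidableEq ι] [Fintype ι] (k : ℕ) (S : Finset ι) (b : ι → ℕ) :
    Finset (ι → ℕ) :=
  Fintype.piFinset fun j => if j ∈ S then Finset.range k else {b j}

lemma mem_gridFace {ι : Type*} [DecidableEq ι] [Fintype ι] {k : ℕ} {S : Finset ι}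
    {b x : ι → ℕ} : x ∈ gridFace k S b ↔ ∀ j, if j ∈ S then x j < k else x j = b j := by
  simp only [gridFace, Fintype.mem_piFinset]
  refine forall_congr' fun j => ?_
  split_ifs <;> simp

lemma sum_gridFace_eq_sum_range {ι : Type*} [DecidableEq ι] [Fintype ι] (k : ℕ) {S : Finset ι}
    {j : ι} (hj : j ∈ S) (b : ι → ℕ) (h : (ι → ℕ) → ZMod 2) :
    ∑ x ∈ gridFace k S b, h x =
      ∑ t ∈ Finset.range k, ∑ x ∈ gridFace k (S.erase j) (Function.update b j t), h x := by
  rw [Finset.sum_sigma']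
  refine Finset.sum_bij' (fun x _ => ⟨x j, x⟩) (fun q _ => q.2) ?_ ?_ ?_ ?_ ?_
  · intro x hx
    simp only [Finset.mem_sigma, mem_gridFace, Finset.mem_range] at hx ⊢
    refine ⟨by simpa [hj] using hx j, fun i => ?_⟩
    have := hx i
    by_cases hij : i = j
    · subst hij; simp
    · simpa [hij] using this
  · rintro ⟨t, x⟩ hx
    simp only [Finset.mem_sigma, mem_gridFace, Finset.mem_range] at hx ⊢
    intro i
    have := hx.2 i
    by_cases hij : i = j
    · subst hij; simp_all
    · simpa [hij] using this
  · intro x _; rfl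
  · rintro ⟨t, x⟩ hx
    simp only [Finset.mem_sigma, mem_gridFace] at hx
    have := hx.2 j
    simp_all
  · intro x _; rfl

lemma sum_gridFace_update_add_single {ι : Type*} [DecidableEq ι] [Fintype ι] (k : ℕ)
    {S : Finset ι} {j : ι} (hj : j ∉ S) (b : ι → ℕ) (t : ℕ) (h : (ι → ℕ) → ZMod 2) :
    ∑ x ∈ gridFace k S (Function.update b j t), h (x + Pi.single j 1) =
      ∑ x ∈ gridFace k S (Function.update b j (t + 1)), h x := by
  refine Finset.sum_bij' (fun x _ => x + Pi.single j 1) (fun x _ => x - Pi.single j 1)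
    ?_ ?_ ?_ ?_ ?_
  · intro x hx
    simp only [mem_gridFace] at hx ⊢
    intro i
    have := hx i
    by_cases hij : i = j
    · subst hij; simp_all
    · simpa [hij] using this
  · intro x hx
    simp only [mem_gridFace] at hx ⊢
    intro i
    have := hx i
    by_cases hij : i = j
    · subst hij; simp_all
    · simpa [hij] using this
  · intro x _
    exact add_tsub_cancel_right _ _
  · intro x hx
    refine tsub_add_cancel_of_le fun i => ?_
    by_cases hij : i = j
    · subst hij
      have := mem_gridFace.mp hx i
      simp_all
    · simp [hij]
  · intro x _; rfl

lemma sum_gridFace_telescope {ι : Type*} [DecidableEq ι] [Fintype ι] (k : ℕ) {S : Finset ι}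
    {j : ι} (hj : j ∈ S) (b : ι → ℕ) (h : (ι → ℕ) → ZMod 2) :
    ∑ x ∈ gridFace k S b, (h (x + Pi.single j 1) - h x) =
      ∑ x ∈ gridFace k (S.erase j) (Function.update b j k), h x -
        ∑ x ∈ gridFace k (S.erase j) (Function.update b j 0), h x := by
  rw [sum_gridFace_eq_sum_range k hj]
  simp only [Finset.sum_sub_distrib,
    sum_gridFace_update_add_single k (Finset.notMem_erase j S)]
  rw [← Finset.sum_sub_distrib]
  exact Finset.sum_range_sub
    (fun t => ∑ x ∈ gridFace k (S.erase j) (Function.update b j t), h x) k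

lemma cupDiff_eq_zero_of_const {ι : Type*} [DecidableEq ι] {L : List ((ι → ℕ) → ZMod 2)}
    {S : Finset ι} {x : ι → ℕ} {f : (ι → ℕ) → ZMod 2} (hf : f ∈ L) {j : ι} (hj : j ∉ S)
    {v : ZMod 2} (hconst : ∀ y : ι → ℕ, y j = x j → f y = v) : cupDiff L S x = 0 := by
  by_contra hne
  obtain ⟨y, hy, z, hz, hyz⟩ := exists_ne_of_cupDiff_ne_zero L S x hne f hf
  have hcoord : ∀ w ∈ Set.Icc x (x + fun i => if i ∈ S then 1 else 0), w j = x j := by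
    intro w hw
    exact le_antisymm (by simpa [hj] using hw.2 j) (hw.1 j)
  exact hyz ((hconst y (hcoord y hy)).trans (hconst z (hcoord z hz)).symm)

lemma sum_gridFace_cupDiff {ι : Type*} [DecidableEq ι] [Fintype ι] (k : ℕ)
    (f : ι → (ι → ℕ) → ZMod 2) (hzero : ∀ i y, y i = 0 → f i y = 0)
    (hone : ∀ i y, y i = k → f i y = 1) (l : List ι) :
    l.Nodup → ∀ b : ι → ℕ,
      ∑ x ∈ gridFace k l.toFinset b, cupDiff (l.map f) l.toFinset x = 1 := by
  induction l with
  | nil =>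
    intro _ b
    have : gridFace k ∅ b = {b} := by
      ext x
      simp [mem_gridFace, funext_iff]
    simp [cupDiff, this]
  | cons a l ih =>
    intro hnodup b
    obtain ⟨hal, hl⟩ := List.nodup_cons.mp hnodup
    have hal' : a ∉ l.toFinset := by simpa using hal
    have hcoord : ∀ {S : Finset ι} {j : ι} {t : ℕ} {x : ι → ℕ},
        x ∈ gridFace k (S.erase j) (Function.update b j t) → x j = t := by
      intro S j t x hx
      simpa using mem_gridFace.mp hx j
    rw [List.map_cons]
    simp only [cupDiff_cons_eq_sum_sub]
    rw [Finset.sum_comm]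
    rw [Finset.sum_congr rfl fun j hj => sum_gridFace_telescope k hj b
      fun x => f a x * cupDiff (l.map f) ((a :: l).toFinset.erase j) x]
    rw [List.toFinset_cons, Finset.sum_insert hal', Finset.sum_eq_zero (s := l.toFinset), add_zero]
    · rw [Finset.sum_congr rfl fun x hx => by rw [hone a x (hcoord hx), one_mul],
        Finset.sum_congr (s₁ := gridFace k _ (Function.update b a 0)) rfl
          fun x hx => by rw [hzero a x (hcoord hx), zero_mul],
        Finset.sum_const_zero, sub_zero, Finset.erase_insert hal']
      exact ih hl _
    · intro j hj
      have hmem : f j ∈ l.map f := List.mem_map_of_mem (by simpa using hj)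
      rw [Finset.sum_eq_zero, Finset.sum_eq_zero, sub_zero]
      · intro x hx
        rw [cupDiff_eq_zero_of_const hmem (Finset.notMem_erase j _)
          fun y hy => hzero j y (hy.trans (hcoord hx)), mul_zero]
      · intro x hx
        rw [cupDiff_eq_zero_of_const hmem (Finset.notMem_erase j _)
          fun y hy => hone j y (hy.trans (hcoord hx)), mul_zero]

/-- A discrete Poincaré–Miranda theorem: if the `i`-th labelling of the grid `{0, …, k}^ι` is `0`
where the `i`-th coordinate is `0`, and `1` where it is `k`, then in some unit cube all the
labellings are nonconstant. -/
lemma exists_cube_forall_ne {ι : Type*} [DecidableEq ι] [Fintype ι] (k : ℕ)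
    (f : ι → (ι → ℕ) → ZMod 2) (hzero : ∀ i y, y i = 0 → f i y = 0)
    (hone : ∀ i y, y i = k → f i y = 1) :
    ∃ x : ι → ℕ, (∀ i, x i < k) ∧
      ∀ i, ∃ y ∈ Set.Icc x (x + 1), ∃ z ∈ Set.Icc x (x + 1), f i y = 1 ∧ f i z = 0 := by
  have hsum := sum_gridFace_cupDiff k f hzero hone Finset.univ.toList (Finset.nodup_toList _) 0
  rw [Finset.toList_toFinset] at hsum
  obtain ⟨x, hx, hne⟩ := Finset.exists_ne_zero_of_sum_ne_zero (hsum.trans_ne one_ne_zero)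
  refine ⟨x, fun i => by simpa using mem_gridFace.mp hx i, fun i => ?_⟩
  obtain ⟨y, hy, z, hz, hyz⟩ := exists_ne_of_cupDiff_ne_zero _ _ _ hne (f i)
    (List.mem_map_of_mem (by simp))
  have hcube : (x + fun i => if i ∈ (Finset.univ : Finset ι) then 1 else 0) = x + 1 := by
    ext i
    simp
  rw [hcube] at hy hz
  have hcases : ∀ u v : ZMod 2, u ≠ v → u = 1 ∧ v = 0 ∨ v = 1 ∧ u = 0 := by decide
  rcases hcases _ _ hyz with h | h
  · exact ⟨y, hy, z, hz, h⟩
  · exact ⟨z, hz, y, hy, h⟩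

/-- Approximate form of the Poincaré–Miranda theorem, without any continuity. -/
lemma exists_forall_dist_le_of_boundary_signs {ι : Type*} [Fintype ι] {a b : ι → ℝ}
    (hab : a ≤ b) (g : (ι → ℝ) → ι → ℝ)
    (hleft : ∀ x ∈ Set.Icc a b, ∀ i, x i = a i → g x i ≤ 0)
    (hright : ∀ x ∈ Set.Icc a b, ∀ i, x i = b i → 0 ≤ g x i) {k : ℕ} (hk : 0 < k) :
    ∃ x ∈ Set.Icc a b, ∀ i, ∃ y ∈ Set.Icc a b, ∃ z ∈ Set.Icc a b,
      dist y x ≤ dist a b / k ∧ dist z x ≤ dist a b / k ∧ 0 ≤ g y i ∧ g z i ≤ 0 := by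
  classical
  have hk' : (0 : ℝ) < k := Nat.cast_pos.mpr hk
  let P : (ι → ℕ) → ι → ℝ := fun y i => a i + (y i / k : ℝ) * (b i - a i)
  have hP : ∀ y : ι → ℕ, (∀ i, y i ≤ k) → P y ∈ Set.Icc a b := by
    intro y hy
    have hfrac : ∀ i, (y i / k : ℝ) ≤ 1 := fun i =>
      (div_le_one hk').mpr (Nat.cast_le.mpr (hy i))
    refine ⟨fun i => ?_, fun i => ?_⟩
    · have := mul_nonneg (div_nonneg (Nat.cast_nonneg (y i)) hk'.le) (sub_nonneg.mpr (hab i))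
      simpa [P] using this
    · have := mul_le_mul_of_nonneg_right (hfrac i) (sub_nonneg.mpr (hab i))
      simp only [P]
      linarith
  let f : ι → (ι → ℕ) → ZMod 2 := fun i y =>
    if y i ≠ 0 ∧ (y i = k ∨ 0 < g (P y) i) then 1 else 0
  obtain ⟨x, hx, hcube⟩ := exists_cube_forall_ne k f (fun i y hy => by simp [f, hy])
    (fun i y hy => by simp [f, hy, hk.ne'])
  have hgrid : ∀ y ∈ Set.Icc x (x + 1), ∀ i, y i ≤ k := fun y hy i =>
    (hy.2 i).trans (hx i)
  have hdist : ∀ y ∈ Set.Icc x (x + 1), dist (P y) (P x) ≤ dist a b / k := by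
    intro y hy
    refine (dist_pi_le_iff (by positivity)).mpr fun i => ?_
    have hlow : (x i : ℝ) ≤ y i := Nat.cast_le.mpr (hy.1 i)
    have hhigh : (y i : ℝ) ≤ x i + 1 := by exact_mod_cast hy.2 i
    have hstep : P y i - P x i = ((y i - x i : ℝ) * (b i - a i)) / k := by
      simp only [P]
      ring
    have hba : b i - a i ≤ dist a b := by
      refine le_trans ?_ (dist_le_pi_dist a b i)
      rw [dist_comm]
      exact le_abs_self _
    have hba' := sub_nonneg.mpr (hab i)
    rw [Real.dist_eq, hstep, abs_of_nonneg (div_nonneg (mul_nonneg (by linarith) hba') hk'.le)]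
    gcongr
    nlinarith
  refine ⟨P x, hP x fun i => (hx i).le, fun i => ?_⟩
  obtain ⟨y, hy, z, hz, hfy, hfz⟩ := hcube i
  refine ⟨P y, hP y (hgrid y hy), P z, hP z (hgrid z hz), hdist y hy, hdist z hz, ?_, ?_⟩
  · have hcond : y i ≠ 0 ∧ (y i = k ∨ 0 < g (P y) i) := by
      by_contra hcon
      simp [f, hcon] at hfy
    rcases hcond.2 with hyk | hpos
    · exact hright _ (hP y (hgrid y hy)) i (by simp [P, hyk, hk'.ne'])
    · exact hpos.le
  · have hcond : ¬ (z i ≠ 0 ∧ (z i = k ∨ 0 < g (P z) i)) := by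
      intro hcon
      simp [f, hcon] at hfz
    by_cases hzi : z i = 0
    · exact hleft _ (hP z (hgrid z hz)) i (by simp [P, hzi])
    · by_contra! hpos
      exact hcond ⟨hzi, Or.inr hpos⟩

/-- The **Poincaré–Miranda theorem**. -/
theorem exists_eq_zero_of_boundary_signs {ι : Type*} [Fintype ι] {a b : ι → ℝ}
    (hab : a ≤ b) {g : (ι → ℝ) → ι → ℝ} (hg : ContinuousOn g (Set.Icc a b))
    (hleft : ∀ x ∈ Set.Icc a b, ∀ i, x i = a i → g x i ≤ 0)
    (hright : ∀ x ∈ Set.Icc a b, ∀ i, x i = b i → 0 ≤ g x i) :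
    ∃ x ∈ Set.Icc a b, g x = 0 := by
  choose x hx y hy z hz hyx hzx hgy hgz using fun m : ℕ =>
    exists_forall_dist_le_of_boundary_signs hab g hleft hright m.succ_pos
  obtain ⟨w, hw, s, hs, hlim⟩ := isCompact_Icc.tendsto_subseq hx
  have hsmall : Filter.Tendsto (fun m => dist a b / ((s m).succ : ℝ)) Filter.atTop (nhds 0) :=
    ((tendsto_const_div_atTop_nhds_zero_nat (dist a b)).comp
      (Filter.tendsto_add_atTop_nat 1)).comp hs.tendsto_atTop
  have hnear : ∀ u : ℕ → ι → ℝ, (∀ m, u m ∈ Set.Icc a b) →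
      (∀ m, dist (u m) (x m) ≤ dist a b / (m.succ : ℝ)) → ∀ i,
      Filter.Tendsto (fun m => g (u (s m)) i) Filter.atTop (nhds (g w i)) := by
    intro u hu hux i
    have hulim : Filter.Tendsto (fun m => u (s m)) Filter.atTop (nhds w) := by
      refine (tendsto_iff_of_dist ?_).mp hlim
      refine squeeze_zero (fun _ => dist_nonneg) (fun m => ?_) hsmall
      rw [dist_comm]
      exact hux (s m)
    exact ((hg w hw).tendsto.comp (tendsto_nhdsWithin_iff.mpr
      ⟨hulim, Filter.Eventually.of_forall fun m => hu (s m)⟩)).apply_nhds i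
  refine ⟨w, hw, funext fun i => le_antisymm ?_ ?_⟩
  · exact le_of_tendsto (hnear (fun m => z m i) (fun m => hz m i) (fun m => hzx m i) i)
      (Filter.Eventually.of_forall fun m => hgz (s m) i)
  · exact ge_of_tendsto (hnear (fun m => y m i) (fun m => hy m i) (fun m => hyx m i) i)
      (Filter.Eventually.of_forall fun m => hgy (s m) i)

theorem stmt12 (n N : ℕ) (c : ℝ) (hc : 0 < c)
    (E : Type*) [NormedAddCommGroup E] [NormedSpace ℝ E]
    (T : E →ₗ[ℝ] (Fin n → ℝ)) (hTinj : Function.Injective T)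
    (hT : ∀ x : E, ‖x‖ ≤ ‖T x‖ ∧ ‖T x‖ ≤ (1 + c) * ‖x‖)
    (p : (Fin N → Fin N → ℝ) → Fin N → E)
    (hcont : Continuous p)
    (hdist : ∀ ε : Fin N → Fin N → ℝ, (∀ i j : Fin N, i < j → ε i j ∈ Set.Icc 0 c) →
      ∀ i j : Fin N, i < j → ‖T (p ε i - p ε j)‖ = 1 + ε i j) :
    ∃ S : Finset E, S.card = N ∧ ∀ x ∈ S, ∀ y ∈ S, x ≠ y → dist x y = 1 := by
  classical
  let g : (Fin N × Fin N → ℝ) → Fin N × Fin N → ℝ := fun ε q =>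
    if q.1 < q.2 then ‖p (Function.curry ε) q.1 - p (Function.curry ε) q.2‖ - 1 else ε q
  have hgcont : Continuous g := by
    have hp : Continuous fun ε : Fin N × Fin N → ℝ => p (Function.curry ε) :=
      hcont.comp (continuous_pi fun i => continuous_pi fun j => continuous_apply (i, j))
    refine continuous_pi fun q => ?_
    by_cases hq : q.1 < q.2
    · simp only [g, if_pos hq]
      exact (((continuous_apply q.1).comp hp).sub
        ((continuous_apply q.2).comp hp)).norm.sub continuous_const
    · simp only [g, if_neg hq]
      exact continuous_apply q
  have hnorm : ∀ ε ∈ Set.Icc (0 : Fin N × Fin N → ℝ) (fun _ => c), ∀ i j, i < j →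
      ‖T (p (Function.curry ε) i - p (Function.curry ε) j)‖ = 1 + ε (i, j) := fun ε hε =>
    hdist _ fun i j _ => ⟨hε.1 (i, j), hε.2 (i, j)⟩
  obtain ⟨ε, -, hzero⟩ := exists_eq_zero_of_boundary_signs
    (a := (0 : Fin N × Fin N → ℝ)) (b := fun _ => c) (fun _ => hc.le) hgcont.continuousOn
    (by
      rintro ε hε ⟨i, j⟩ hq
      by_cases hij : i < j
      · have hle := (hT (p (Function.curry ε) i - p (Function.curry ε) j)).1
        rw [hnorm ε hε i j hij, hq] at hle
        simp only [g, if_pos hij]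
        simpa using hle
      · simp only [g, if_neg hij, hq]
        exact le_rfl)
    (by
      rintro ε hε ⟨i, j⟩ hq
      by_cases hij : i < j
      · have hle := (hT (p (Function.curry ε) i - p (Function.curry ε) j)).2
        rw [hnorm ε hε i j hij, hq] at hle
        simp only [g, if_pos hij]
        have := le_of_mul_le_mul_left ((mul_one (1 + c)).trans_le hle) (by linarith)
        linarith
      · simp only [g, if_neg hij, hq]
        exact hc.le)
  set P := p (Function.curry ε)
  have hlt : ∀ i j, i < j → dist (P i) (P j) = 1 := by
    intro i j hij
    have := congrFun hzero (i, j)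
    simp only [g, if_pos hij, Pi.zero_apply] at this
    rw [dist_eq_norm]
    linarith
  have hne : ∀ i j, i ≠ j → dist (P i) (P j) = 1 := by
    intro i j hij
    rcases lt_or_gt_of_ne hij with h | h
    · exact hlt i j h
    · rw [dist_comm]
      exact hlt j i h
  have hinj : Function.Injective P := by
    intro i j hPij
    by_contra hij
    have := hne i j hij
    rw [hPij, dist_self] at this
    exact zero_ne_one this
  refine ⟨Finset.univ.image P, by simp [Finset.card_image_of_injective _ hinj], ?_⟩
  simp only [Finset.mem_image, Finset.mem_univ, true_and]
  rintro _ ⟨i, rfl⟩ _ ⟨j, rfl⟩ hij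
  exact hne i j fun h => hij (h ▸ rfl)
end
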